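/- Let (Ω, 𝓕, P) be a probability space and let C > 0. Let B_1 ≤ B_2 ≤ … be a nondecreasing sequence of measurable random variables with values in the positive reals such that P( B_r ≤ (1/λ)·r² ) ≤ C/λ and P( B_r ≥ λ·r² ) ≤ C/λ for every real λ > 1 and every integer r ≥ 1. Then P( lim_{r→∞} (log B_r)/(log r) = 2 ) = 1, i.e. almost surely the limit exists and equals 2. -/

import Mathlib

open MeasureTheory Filter

/-- The quantity `log (2 x + 3)` is negligible compared with `x` as `x → ∞`. -/
lemma tendsto_const_add_log_div_atTop_zero :
    Tendsto (fun x : ℝ => (2 * Real.log 2 + 2 * Real.log (2 * x + 3)) / x) atTop (nhds 0) := by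
  have hlin : (fun x : ℝ => 2 * x + 3) =O[atTop] (fun x : ℝ => x) := by
    refine Asymptotics.IsBigO.add (Asymptotics.isBigO_const_mul_self _ _ _) ?_
    exact (Asymptotics.isLittleO_const_id_atTop (3 : ℝ)).isBigO
  have htop : Tendsto (fun x : ℝ => 2 * x + 3) atTop atTop :=
    tendsto_atTop_add_const_right _ _ (tendsto_id.const_mul_atTop (by norm_num))
  have hlog : (fun x : ℝ => Real.log (2 * x + 3)) =o[atTop] (fun x : ℝ => x) :=
    (Real.isLittleO_log_id_atTop.comp_tendsto htop).trans_isBigO hlin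
  exact ((Asymptotics.isLittleO_const_id_atTop (2 * Real.log 2)).add
    (hlog.const_mul_left 2)).tendsto_div_nhds_zero

/-- A positive nondecreasing sequence which is within a factor `(k + 2) ^ 2` of `(2 ^ k) ^ 2` at
all large dyadic times `2 ^ k` has growth exponent `2`. -/
lemma tendsto_log_div_log_of_dyadic_bounds (b : ℕ → ℝ)
    (hpos : ∀ r : ℕ, 1 ≤ r → 0 < b r) (hmono : ∀ r : ℕ, 1 ≤ r → b r ≤ b (r + 1))
    (hlower : ∀ᶠ k : ℕ in atTop, 1 / ((k : ℝ) + 2) ^ 2 * ((2 ^ k : ℕ) : ℝ) ^ 2 < b (2 ^ k))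
    (hupper : ∀ᶠ k : ℕ in atTop, b (2 ^ k) < ((k : ℝ) + 2) ^ 2 * ((2 ^ k : ℕ) : ℝ) ^ 2) :
    Tendsto (fun r : ℕ => Real.log (b r) / Real.log r) atTop (nhds 2) := by
  have hle : ∀ r s : ℕ, 1 ≤ r → r ≤ s → b r ≤ b s := fun r s hr hrs => by
    induction s, hrs using Nat.le_induction with
    | base => exact le_rfl
    | succ n hn ih => exact ih.trans (hmono n (hr.trans hn))
  have hlogr : Tendsto (fun r : ℕ => Real.log r) atTop atTop :=
    Real.tendsto_log_atTop.comp tendsto_natCast_atTop_atTop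
  have hk : Tendsto (fun r : ℕ => Nat.log 2 r) atTop atTop :=
    tendsto_atTop_atTop.2 fun n => ⟨2 ^ n, fun r hr => Nat.le_log_of_pow_le (by norm_num) hr⟩
  rw [tendsto_iff_norm_sub_tendsto_zero]
  refine squeeze_zero' (Eventually.of_forall fun _ => norm_nonneg _) ?_
    (tendsto_const_add_log_div_atTop_zero.comp hlogr)
  filter_upwards [hk.eventually hlower,
    ((tendsto_add_atTop_nat 1).comp hk).eventually hupper,
    hlogr.eventually_gt_atTop 0, eventually_ge_atTop 1] with r hl hu hr0 hr1
  simp only [Function.comp_apply] at hu ⊢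
  set k := Nat.log 2 r
  have hkr : 2 ^ k ≤ r := Nat.pow_log_le_self 2 (by omega)
  have hrk : r ≤ 2 ^ (k + 1) := (Nat.lt_pow_succ_log_self (by norm_num) r).le
  have hr1' : (0 : ℝ) < r := by exact_mod_cast hr1
  have hlog2 : (1 : ℝ) / 2 < Real.log 2 := by linarith [Real.log_two_gt_d9]
  have h1 : k * Real.log 2 ≤ Real.log r := by
    rw [← Real.log_pow]
    exact Real.log_le_log (by positivity) (by exact_mod_cast hkr)
  have h2 : Real.log r ≤ (k + 1) * Real.log 2 := by
    have := Real.log_le_log hr1' (show (r : ℝ) ≤ 2 ^ (k + 1) by exact_mod_cast hrk)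
    rw [Real.log_pow] at this
    exact_mod_cast this
  have hk3 : Real.log ((k : ℝ) + 3) ≤ Real.log (2 * Real.log r + 3) :=
    Real.log_le_log (by positivity)
      (by nlinarith [(Nat.cast_nonneg k : (0 : ℝ) ≤ k)])
  have hk2 : Real.log ((k : ℝ) + 2) ≤ Real.log ((k : ℝ) + 3) :=
    Real.log_le_log (by positivity) (by linarith)
  have h3 : Real.log (b r) ≤ 2 * Real.log ((k : ℝ) + 3) + 2 * ((k + 1) * Real.log 2) := by
    have := Real.log_le_log (hpos r hr1) ((hle r _ hr1 hrk).trans hu.le)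
    rw [Real.log_mul (by positivity) (by positivity), Real.log_pow, Real.log_pow] at this
    push_cast at this
    rw [Real.log_pow, show (k : ℝ) + 1 + 2 = k + 3 by ring] at this
    push_cast at this
    exact this
  have h4 : 2 * (k * Real.log 2) - 2 * Real.log ((k : ℝ) + 2) ≤ Real.log (b r) := by
    have := Real.log_le_log (by positivity) (hl.le.trans (hle _ r Nat.one_le_two_pow hkr))
    rw [Real.log_mul (by positivity) (by positivity), one_div, Real.log_inv, Real.log_pow,
      Real.log_pow] at this
    push_cast at this
    rw [Real.log_pow] at this
    linarith
  have h5 : Real.log (b r) / Real.log r - 2 = (Real.log (b r) - 2 * Real.log r) / Real.log r := by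
    field_simp
  rw [h5, Real.norm_eq_abs, abs_div, abs_of_pos hr0]
  gcongr
  rw [abs_le]
  constructor <;> linarith

/-- Abstract form of Theorem 2 (volume growth exponent of the IIC is 2):
if `P(B_r ≤ (1/λ)·r²) ≤ C/λ` and `P(B_r ≥ λ·r²) ≤ C/λ`,
then almost surely `lim (log B_r)/(log r) = 2`. -/
theorem volume_growth_exponent_two
    {Ω : Type*} [MeasurableSpace Ω] (P : Measure Ω) [IsProbabilityMeasure P]
    (C : ℝ) (hC : 0 < C)
    (B : ℕ → Ω → ℝ)
    (hmeas : ∀ r, Measurable (B r))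
    (hpos : ∀ r : ℕ, 1 ≤ r → ∀ ω, 0 < B r ω)
    (hmono : ∀ r : ℕ, 1 ≤ r → ∀ ω, B r ω ≤ B (r + 1) ω)
    (hLower : ∀ l : ℝ, 1 < l → ∀ r : ℕ, 1 ≤ r →
      P {ω | B r ω ≤ (1 / l) * (r : ℝ) ^ 2} ≤ ENNReal.ofReal (C / l))
    (hUpper : ∀ l : ℝ, 1 < l → ∀ r : ℕ, 1 ≤ r →
      P {ω | l * (r : ℝ) ^ 2 ≤ B r ω} ≤ ENNReal.ofReal (C / l)) :
    P {ω | Tendsto (fun r : ℕ => Real.log (B r ω) / Real.log r) atTop (nhds 2)} = 1 := by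
  have hsum : Summable fun k : ℕ => C / ((k : ℝ) + 2) ^ 2 := by
    have h := (summable_nat_add_iff 2).2 (Real.summable_one_div_nat_pow.2 one_lt_two)
    simpa [div_eq_mul_inv] using h.mul_left C
  have hl : ∀ k : ℕ, 1 < ((k : ℝ) + 2) ^ 2 := fun k => by
    nlinarith [(Nat.cast_nonneg k : (0 : ℝ) ≤ k)]
  have hlower := ae_eventually_notMem (ne_top_of_le_ne_top hsum.tsum_ofReal_ne_top
    (ENNReal.tsum_le_tsum fun k : ℕ => hLower _ (hl k) (2 ^ k) Nat.one_le_two_pow))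
  have hupper := ae_eventually_notMem (ne_top_of_le_ne_top hsum.tsum_ofReal_ne_top
    (ENNReal.tsum_le_tsum fun k : ℕ => hUpper _ (hl k) (2 ^ k) Nat.one_le_two_pow))
  have hae : ∀ᵐ ω ∂P,
      Tendsto (fun r : ℕ => Real.log (B r ω) / Real.log r) atTop (nhds 2) := by
    filter_upwards [hlower, hupper] with ω h₁ h₂
    exact tendsto_log_div_log_of_dyadic_bounds (fun r => B r ω) (fun r hr => hpos r hr ω)
      (fun r hr => hmono r hr ω) (h₁.mono fun k hk => not_le.1 hk)
      (h₂.mono fun k hk => not_le.1 hk)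
  rw [measure_congr (eventuallyEq_univ.2 hae), measure_univ]
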